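/- arXiv:2207.08906 — 8 statements merged into one kernel-verified Lean document; each statement's English description precedes it below -/
import Mathlib

section
/- For every m ≥ 1 and positive integers a_1,…,a_{2m}, the first column of the 2×2 matrix M^+(a_1,…,a_{2m})_q over ℤ[q,q⁻¹] is the vector (q·K_{2m}(a_1,…,a_{2m})_q, q·K_{2m−1}(a_2,…,a_{2m})_q). -/
open LaurentPolynomial in
/-- The `q`-integer `[c]_q = 1 + q + ⋯ + q^{c-1}` in `ℤ[q,q⁻¹]`. -/
noncomputable def qLp (c : ℕ) : LaurentPolynomial ℤ := ∑ i ∈ Finset.range c, T (i : ℤ)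

open LaurentPolynomial in
/-- The `q`-integer `[c]_{q⁻¹} = 1 + q⁻¹ + ⋯ + q^{−(c−1)}` in `ℤ[q,q⁻¹]`. -/
noncomputable def qLm (c : ℕ) : LaurentPolynomial ℤ := ∑ i ∈ Finset.range c, T (-(i : ℤ))

open LaurentPolynomial in
/-- The tridiagonal matrix of size `n` whose rows/columns correspond to the paper's
(1-indexed) positions `s+1, …, s+n` of the tuple `a` (0-indexed: `a 0 = a_1`):
diagonal entry at position `p` is `[a_p]_q` for `p` odd (1-indexed), `[a_p]_{q⁻¹}` for `p` even;
the `(p, p+1)` entry is `q^{a_p}` for `p` odd and `q^{−a_p}` for `p` even; subdiagonal entries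
are `−1`. Here a 0-indexed position `(i : ℕ) + s` is even iff the 1-indexed position is odd. -/
noncomputable def Kmat (n s : ℕ) (a : ℕ → ℕ) : Matrix (Fin n) (Fin n) (LaurentPolynomial ℤ) :=
  Matrix.of fun i j =>
    if (i : ℕ) = (j : ℕ) then
      (if ((i : ℕ) + s) % 2 = 0 then qLp (a ((i : ℕ) + s)) else qLm (a ((i : ℕ) + s)))
    else if (j : ℕ) = (i : ℕ) + 1 then
      (if ((i : ℕ) + s) % 2 = 0 then T ((a ((i : ℕ) + s) : ℤ)) else T (-(a ((i : ℕ) + s) : ℤ)))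
    else if (i : ℕ) = (j : ℕ) + 1 then -1
    else 0

/-- The sum `a_2 + a_4 + ⋯ + a_{2m}` of even-position entries (0-indexed `a`). -/
noncomputable def Ksum (m : ℕ) (a : ℕ → ℕ) : ℤ := ∑ j ∈ Finset.range m, (a (2 * j + 1) : ℤ)

open LaurentPolynomial in
/-- The `q`-continuant `K_{2m}(a_1,…,a_{2m})_q ∈ ℤ[q,q⁻¹]` (0-indexed `a`). -/
noncomputable def Kcont (m : ℕ) (a : ℕ → ℕ) : LaurentPolynomial ℤ :=
  T (Ksum m a - 1) * (Kmat (2 * m) 0 a).det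

open LaurentPolynomial in
/-- The `q`-continuant `K_{2m−1}(a_2,…,a_{2m})_q ∈ ℤ[q,q⁻¹]` (same prefactor, first
row and column removed). -/
noncomputable def Kcont' (m : ℕ) (a : ℕ → ℕ) : LaurentPolynomial ℤ :=
  T (Ksum m a - 1) * (Kmat (2 * m - 1) 1 a).det

open LaurentPolynomial in
/-- The elementary factor `A_i` of `M^+`: for a 0-indexed position `i` (1-indexed `i+1`),
`A = [[ [a_i]_q, q^{a_i} ], [1,0]]` at odd 1-indexed positions and
`A = [[ [a_i]_{q⁻¹}, q^{−a_i} ], [1,0]]` at even 1-indexed positions. -/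
noncomputable def MplusF (a : ℕ → ℕ) (i : ℕ) : Matrix (Fin 2) (Fin 2) (LaurentPolynomial ℤ) :=
  if i % 2 = 0 then !![qLp (a i), T ((a i : ℤ)); 1, 0]
  else !![qLm (a i), T (-(a i : ℤ)); 1, 0]

open LaurentPolynomial in
/-- The matrix `M^+(a_1,…,a_{2m})_q = q^{a_2+⋯+a_{2m}} ∏_{i=1}^{2m} A_i` over `ℤ[q,q⁻¹]`. -/
noncomputable def Mplus (m : ℕ) (a : ℕ → ℕ) : Matrix (Fin 2) (Fin 2) (LaurentPolynomial ℤ) :=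
  (T (Ksum m a) : LaurentPolynomial ℤ) • ((List.range (2 * m)).map (MplusF a)).prod

/-- Removing the first row and column of `Kmat` shifts the starting position. -/
lemma Kmat_succ_succ (n s : ℕ) (a : ℕ → ℕ) (i j : Fin n) :
    Kmat (n + 1) s a i.succ j.succ = Kmat n (s + 1) a i j := by
  have h : (i : ℕ) + 1 + s = i + (s + 1) := by omega
  simp only [Kmat, Matrix.of_apply, Fin.val_succ, h, add_left_inj]

lemma Kmat_zero_zero (n s : ℕ) (a : ℕ → ℕ) :
    Kmat (n + 1) s a 0 0 = MplusF a s 0 0 := by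
  by_cases h : s % 2 = 0 <;> simp [Kmat, MplusF, h]

lemma Kmat_zero_one (n s : ℕ) (a : ℕ → ℕ) :
    Kmat (n + 2) s a 0 1 = MplusF a s 0 1 := by
  by_cases h : s % 2 = 0 <;> simp [Kmat, MplusF, h]

lemma Kmat_one_zero (n s : ℕ) (a : ℕ → ℕ) :
    Kmat (n + 2) s a 1 0 = -1 := by
  simp [Kmat]

lemma Kmat_zero_far (n s : ℕ) (a : ℕ → ℕ) (j : Fin n) :
    Kmat (n + 2) s a 0 j.succ.succ = 0 := by
  simp [Kmat]

lemma Kmat_far_zero (n s : ℕ) (a : ℕ → ℕ) (j : Fin n) :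
    Kmat (n + 2) s a j.succ.succ 0 = 0 := by
  simp [Kmat]

lemma Kmat_det_rec (n s : ℕ) (a : ℕ → ℕ) :
    (Kmat (n + 2) s a).det = MplusF a s 0 0 * (Kmat (n + 1) (s + 1) a).det
      + MplusF a s 0 1 * (Kmat n (s + 2) a).det := by
  have h0 : (Kmat (n + 2) s a).submatrix (Fin.succAbove 0) Fin.succ = Kmat (n + 1) (s + 1) a := by
    ext1 i j
    simp [Kmat_succ_succ]
  have h1 : ((Kmat (n + 2) s a).submatrix (Fin.succAbove 1) Fin.succ).det
      = MplusF a s 0 1 * (Kmat n (s + 2) a).det := by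
    rw [Matrix.det_succ_row_zero, Fin.sum_univ_succ, Finset.sum_eq_zero]
    · have h2 : ((Kmat (n + 2) s a).submatrix (Fin.succAbove 1) Fin.succ).submatrix Fin.succ
          (Fin.succAbove 0) = Kmat n (s + 2) a := by
        ext1 i j
        have : Fin.succAbove (1 : Fin (n + 2)) i.succ = i.succ.succ := by
          rw [← Fin.succ_zero_eq_one, Fin.succ_succAbove_succ]; simp
        simp [Kmat_succ_succ, this]
      rw [h2]
      simp [Kmat_zero_one]
    · intro j _
      simp [Kmat_zero_far]
  rw [Matrix.det_succ_column_zero, Fin.sum_univ_succ, Fin.sum_univ_succ, Finset.sum_eq_zero]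
  · rw [h0, Fin.succ_zero_eq_one, h1, Kmat_zero_zero, Kmat_one_zero]
    simp
  · intro j _
    simp [Kmat_far_zero]

/-- The product of `n` consecutive elementary factors starting at position `s`. -/
noncomputable def MprodFrom (a : ℕ → ℕ) : ℕ → ℕ → Matrix (Fin 2) (Fin 2) (LaurentPolynomial ℤ)
  | 0, _ => 1
  | n + 1, s => MplusF a s * MprodFrom a n (s + 1)

lemma MprodFrom_eq (a : ℕ → ℕ) (n s : ℕ) :
    ((List.range' s n).map (MplusF a)).prod = MprodFrom a n s := by
  induction n generalizing s with
  | zero => simp [MprodFrom]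
  | succ n ih => simp [MprodFrom, List.range'_succ, ih]

lemma MprodFrom_one_zero (a : ℕ → ℕ) (n s : ℕ) :
    MprodFrom a (n + 1) s 1 0 = MprodFrom a n (s + 1) 0 0 := by
  by_cases h : s % 2 = 0 <;> simp [MprodFrom, Matrix.mul_apply, MplusF, h]

lemma MprodFrom_zero_zero (a : ℕ → ℕ) (n s : ℕ) :
    MprodFrom a n s 0 0 = (Kmat n s a).det := by
  induction n using Nat.twoStepInduction generalizing s with
  | zero => simp [MprodFrom]
  | one => simp [MprodFrom, Kmat_zero_zero]
  | more n ih0 ih1 =>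
    rw [Kmat_det_rec, ← ih0, ← ih1, MprodFrom, Matrix.mul_apply, Fin.sum_univ_two,
      MprodFrom_one_zero]

open LaurentPolynomial in
/-- for `m ≥ 1` and positive integers `a_1,…,a_{2m}`, the first column of
`M^+(a_1,…,a_{2m})_q` is `(q·K_{2m}(a_1,…,a_{2m})_q, q·K_{2m−1}(a_2,…,a_{2m})_q)`. -/
theorem Mplus_first_column (m : ℕ) (hm : 1 ≤ m) (a : ℕ → ℕ) (ha : ∀ i < 2 * m, 0 < a i) :
    Mplus m a 0 0 = T 1 * Kcont m a ∧ Mplus m a 1 0 = T 1 * Kcont' m a := by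
  have hT : (T 1 : LaurentPolynomial ℤ) * T (Ksum m a - 1) = T (Ksum m a) := by
    rw [← T_add]; congr 1; ring
  obtain ⟨k, hk⟩ : ∃ k, 2 * m = k + 1 := ⟨2 * m - 1, by omega⟩
  rw [Mplus, Kcont, Kcont', List.range_eq_range', MprodFrom_eq, ← mul_assoc, ← mul_assoc, hT,
    Matrix.smul_apply, Matrix.smul_apply, smul_eq_mul, smul_eq_mul, MprodFrom_zero_zero]
  refine ⟨rfl, ?_⟩
  rw [hk, MprodFrom_one_zero, MprodFrom_zero_zero]
  rfl
end

section
/- Let k ≥ 1 and let c_1,…,c_k be integers with c_i ≥ 2 for all i. In the field ℚ(q) of rational functions, define x_k = [c_k]_q and, descending, x_i = [c_i]_q − q^{c_i−1}/x_{i+1} for 1 ≤ i ≤ k−1. Then for every 1 ≤ i ≤ k one has x_i ≠ 0 and x_i = E_{k−i+1}(c_i,…,c_k)_q / E_{k−i}(c_{i+1},…,c_k)_q; in particular x_1 = E_k(c_1,…,c_k)_q / E_{k−1}(c_2,…,c_k)_q. -/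
/-- The `q`-integer `[c]_q = 1 + q + ⋯ + q^{c-1}` in `ℤ[q]`. -/
noncomputable def qN (c : ℕ) : Polynomial ℤ := ∑ i ∈ Finset.range c, Polynomial.X ^ i

/-- The tridiagonal matrix whose determinant is the `q`-continuant
`E_k(c_1,…,c_k)_q` (here `c` is 0-indexed: `c 0 = c_1`). -/
noncomputable def Emat (k : ℕ) (c : ℕ → ℕ) : Matrix (Fin k) (Fin k) (Polynomial ℤ) :=
  Matrix.of fun i j =>
    if (i : ℕ) = (j : ℕ) then qN (c i)
    else if (j : ℕ) = (i : ℕ) + 1 then Polynomial.X ^ (c i - 1)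
    else if (i : ℕ) = (j : ℕ) + 1 then 1
    else 0

/-- The `q`-continuant `E_k(c_1,…,c_k)_q ∈ ℤ[q]` (0-indexed `c`); `Econt 0 c = 1`. -/
noncomputable def Econt (k : ℕ) (c : ℕ → ℕ) : Polynomial ℤ := (Emat k c).det

/-- The matrix `M(c_1,…,c_k)_q = ∏_{i=1}^{k} [[ [c_i]_q, −q^{c_i−1} ], [1, 0]]` over `ℤ[q]`. -/
noncomputable def Mmat (k : ℕ) (c : ℕ → ℕ) : Matrix (Fin 2) (Fin 2) (Polynomial ℤ) :=
  ((List.range k).map fun i => !![qN (c i), -(Polynomial.X ^ (c i - 1)); 1, 0]).prod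

/-- The `q`-integer `[c]_q` in the field `ℚ(q)` of rational functions. -/
noncomputable def qF (c : ℕ) : RatFunc ℚ := ∑ i ∈ Finset.range c, RatFunc.X ^ i

/-- The `q`-integer `[c]_{q⁻¹} = 1 + q⁻¹ + ⋯ + q^{−(c−1)}` in `ℚ(q)`. -/
noncomputable def qFinv (c : ℕ) : RatFunc ℚ := ∑ i ∈ Finset.range c, RatFunc.X ^ (-(i : ℤ))

/-- The canonical embedding `ℤ[q] → ℚ(q)`. -/
noncomputable def polyToRat : Polynomial ℤ →+* RatFunc ℚ :=
  (algebraMap (Polynomial ℚ) (RatFunc ℚ)).comp (Polynomial.mapRingHom (Int.castRingHom ℚ))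

lemma Econt_zero (c : ℕ → ℕ) : Econt 0 c = 1 := by simp [Econt]

lemma Econt_one (c : ℕ → ℕ) : Econt 1 c = qN (c 0) := by simp [Econt, Emat]

lemma Econt_rec (n : ℕ) (c : ℕ → ℕ) :
    Econt (n + 2) c = qN (c 0) * Econt (n + 1) (fun j => c (j + 1))
      - Polynomial.X ^ (c 0 - 1) * Econt n (fun j => c (j + 2)) := by
  have h0 : (Emat (n + 2) c).submatrix (Fin.succAbove 0) Fin.succ
      = Emat (n + 1) (fun j => c (j + 1)) := by
    ext1 i j
    simp [Emat]
  have h2 : (((Emat (n + 2) c).submatrix (Fin.succAbove (Fin.succ 0)) Fin.succ).submatrix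
      Fin.succ (Fin.succAbove 0)) = Emat n (fun j => c (j + 2)) := by
    ext1 i j
    simp [Emat]
  have h1 : ((Emat (n + 2) c).submatrix (Fin.succAbove (Fin.succ 0)) Fin.succ).det
      = Polynomial.X ^ (c 0 - 1) * Econt n (fun j => c (j + 2)) := by
    rw [Matrix.det_succ_row_zero, Fin.sum_univ_succ, h2, Finset.sum_eq_zero]
    · simp [Emat, Econt]
    · intro j _
      simp [Emat]
  unfold Econt at *
  rw [Matrix.det_succ_column_zero, Fin.sum_univ_succ, Fin.sum_univ_succ, h0, h1,
    Finset.sum_eq_zero]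
  · simp [Emat]
    ring
  · intro j _
    simp [Emat]

lemma Econt_eval (n : ℕ) : ∀ c : ℕ → ℕ, (∀ i < n + 1, 2 ≤ c i) →
    0 < (Econt n (fun j => c (j + 1))).eval 1 ∧
    (Econt n (fun j => c (j + 1))).eval 1 < (Econt (n + 1) c).eval 1 := by
  induction n with
  | zero =>
    intro c hc
    have := hc 0 (by omega)
    simp [Econt_zero, Econt_one, qN, Polynomial.eval_finsetSum]
    omega
  | succ n ih =>
    intro c hc
    obtain ⟨h1, h2⟩ := ih (fun j => c (j + 1)) (fun i hi => hc (i + 1) (by omega))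
    have h3 : (2 : ℤ) ≤ c 0 := by exact_mod_cast hc 0 (by omega)
    have h4 : (qN (c 0)).eval 1 = (c 0 : ℤ) := by simp [qN, Polynomial.eval_finsetSum]
    rw [Econt_rec]
    simp only [Polynomial.eval_sub, Polynomial.eval_mul, Polynomial.eval_pow, Polynomial.eval_X,
      one_pow, one_mul, h4]
    simp only [add_assoc, Nat.reduceAdd] at h1 h2 ⊢
    constructor
    · linarith
    · nlinarith

lemma Econt_ne (n : ℕ) (c : ℕ → ℕ) (hc : ∀ i < n, 2 ≤ c i) : Econt n c ≠ 0 := by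
  cases n with
  | zero => simp [Econt_zero]
  | succ n =>
    obtain ⟨h1, h2⟩ := Econt_eval n c hc
    intro h
    rw [h] at h2
    simp at h2
    omega

lemma polyToRat_inj : Function.Injective polyToRat := by
  unfold polyToRat
  rw [RingHom.coe_comp]
  exact (RatFunc.algebraMap_injective ℚ).comp
    (Polynomial.map_injective _ (RingHom.injective_int _))

lemma polyToRat_X : polyToRat Polynomial.X = RatFunc.X := by
  simp [polyToRat]

lemma polyToRat_qN (c : ℕ) : polyToRat (qN c) = qF c := by
  simp [qN, qF, polyToRat_X]

/-- for `k ≥ 1` and integers `c_i ≥ 2` (0-indexed, `c 0 = c_1`), if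
`x_{k} = [c_k]_q` and `x_i = [c_i]_q − q^{c_i−1}/x_{i+1}` descending, then each
`x_i ≠ 0` and `x_i = E_{k−i+1}(c_i,…,c_k)_q / E_{k−i}(c_{i+1},…,c_k)_q` in `ℚ(q)`;
in particular `x_1 = E_k(c_1,…,c_k)_q / E_{k−1}(c_2,…,c_k)_q`. -/
theorem negative_cf_tails (k : ℕ) (hk : 1 ≤ k) (c : ℕ → ℕ) (hc : ∀ i < k, 2 ≤ c i)
    (x : ℕ → RatFunc ℚ)
    (hlast : x (k - 1) = qF (c (k - 1)))
    (hrec : ∀ i, i + 1 < k → x i = qF (c i) - RatFunc.X ^ (c i - 1) / x (i + 1)) :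
    ∀ i < k, x i ≠ 0 ∧
      x i = polyToRat (Econt (k - i) (fun j => c (j + i))) /
              polyToRat (Econt (k - 1 - i) (fun j => c (j + i + 1))) := by
  have ne : ∀ n (d : ℕ → ℕ), (∀ i < n, 2 ≤ d i) → polyToRat (Econt n d) ≠ 0 := by
    intro n d hd h
    exact Econt_ne n d hd (polyToRat_inj (by rw [h, map_zero]))
  have key : ∀ n i, i + n + 1 = k → x i ≠ 0 ∧
      x i = polyToRat (Econt (n + 1) (fun j => c (j + i))) /
              polyToRat (Econt n (fun j => c (j + i + 1))) := by
    intro n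
    induction n with
    | zero =>
      intro i hi
      have hx : x i = polyToRat (Econt 1 (fun j => c (j + i))) := by
        have : i = k - 1 := by omega
        rw [Econt_one, polyToRat_qN, zero_add, this, hlast]
      refine ⟨?_, ?_⟩
      · rw [hx]
        exact ne _ _ (fun j hj => hc _ (by omega))
      · rw [Econt_zero, map_one, div_one, hx]
    | succ n ih =>
      intro i hi
      obtain ⟨_, h2⟩ := ih (i + 1) (by omega)
      have n0 := ne (n + 2) (fun j => c (j + i)) (fun j hj => hc _ (by omega))
      have n1 := ne (n + 1) (fun j => c (j + i + 1)) (fun j hj => hc _ (by omega))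
      have n2 := ne n (fun j => c (j + i + 2)) (fun j hj => hc _ (by omega))
      have hx : x i = polyToRat (Econt (n + 2) (fun j => c (j + i))) /
              polyToRat (Econt (n + 1) (fun j => c (j + i + 1))) := by
        have e1 : (fun j => c (j + 1 + i)) = fun j => c (j + i + 1) := by
          funext j; grind
        have e2 : (fun j => c (j + 2 + i)) = fun j => c (j + i + 2) := by
          funext j; grind
        have e3 : (fun j => c (j + (i + 1) + 1)) = fun j => c (j + i + 2) := by
          funext j; grind
        have e4 : (fun j => c (j + (i + 1))) = fun j => c (j + i + 1) := rfl
        rw [hrec i (by omega), h2, Econt_rec, e1, e2, e3, e4, map_sub, map_mul, map_mul,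
          map_pow, polyToRat_X, polyToRat_qN, zero_add]
        field_simp
      refine ⟨?_, hx⟩
      rw [hx]
      exact div_ne_zero n0 n1
  intro i hi
  have := key (k - 1 - i) i (by omega)
  rwa [show k - 1 - i + 1 = k - i by omega] at this
end

section
/- Let m ≥ 1, let a_1,…,a_{2m} be positive integers, and let (c_1,…,c_k) be the Hirzebruch conversion of (a_1,…,a_{2m}). In the field ℚ(q) of rational functions, the q-deformed regular continued fraction [a_1]_q + q^{a_1}/([a_2]_{q⁻¹} + q^{−a_2}/(⋯ + q^{a_{2m−1}}/[a_{2m}]_{q⁻¹})) (where the i-th level uses [a_i]_q and numerator q^{a_i} for i odd, and [a_i]_{q⁻¹} and numerator q^{−a_i} for i even) equals the q-deformed negative continued fraction [c_1]_q − q^{c_1−1}/([c_2]_q − q^{c_2−1}/(⋯ − q^{c_{k−1}−1}/[c_k]_q)), and all intermediate tails of both continued fractions are nonzero. -/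
/-- The Hirzebruch conversion of `(a_1,…,a_{2m})` (0-indexed `a`): the list
`(a_1+1, 2,…,2 (a_2−1 times), a_3+2, 2,…,2 (a_4−1 times), …, a_{2m−1}+2, 2,…,2 (a_{2m}−1 times))`,
of length `a_2 + a_4 + ⋯ + a_{2m}`. -/
def hirz (m : ℕ) (a : ℕ → ℕ) : List ℕ :=
  ((List.range m).map fun j =>
    (if j = 0 then a 0 + 1 else a (2 * j) + 2) :: List.replicate (a (2 * j + 1) - 1) 2).flatten

open Polynomial in
/-- Rational functions that are regular and positive at `q = 1`. -/
def QPos (f : RatFunc ℚ) : Prop :=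
  ∃ p r : ℚ[X], 0 < p.eval 1 ∧ 0 < r.eval 1 ∧
    f = algebraMap ℚ[X] (RatFunc ℚ) p / algebraMap ℚ[X] (RatFunc ℚ) r

lemma algMap_ne_zero {p : Polynomial ℚ} (h : 0 < p.eval 1) :
    algebraMap (Polynomial ℚ) (RatFunc ℚ) p ≠ 0 := by
  apply RatFunc.algebraMap_ne_zero
  rintro rfl
  simp at h

lemma QPos.ne_zero {f : RatFunc ℚ} (h : QPos f) : f ≠ 0 := by
  obtain ⟨p, r, hp, hr, rfl⟩ := h
  exact div_ne_zero (algMap_ne_zero hp) (algMap_ne_zero hr)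

lemma QPos.add {f g : RatFunc ℚ} (hf : QPos f) (hg : QPos g) : QPos (f + g) := by
  obtain ⟨p, r, hp, hr, rfl⟩ := hf
  obtain ⟨p', r', hp', hr', rfl⟩ := hg
  refine ⟨p * r' + r * p', r * r', ?_, ?_, ?_⟩
  · simp only [Polynomial.eval_add, Polynomial.eval_mul]; positivity
  · simp only [Polynomial.eval_mul]; positivity
  · rw [div_add_div _ _ (algMap_ne_zero hr) (algMap_ne_zero hr')]
    simp only [map_add, map_mul]

lemma QPos.mul {f g : RatFunc ℚ} (hf : QPos f) (hg : QPos g) : QPos (f * g) := by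
  obtain ⟨p, r, hp, hr, rfl⟩ := hf
  obtain ⟨p', r', hp', hr', rfl⟩ := hg
  refine ⟨p * p', r * r', ?_, ?_, ?_⟩
  · simp only [Polynomial.eval_mul]; positivity
  · simp only [Polynomial.eval_mul]; positivity
  · rw [div_mul_div_comm]
    simp only [map_mul]

lemma QPos.inv {f : RatFunc ℚ} (hf : QPos f) : QPos f⁻¹ := by
  obtain ⟨p, r, hp, hr, rfl⟩ := hf
  exact ⟨r, p, hr, hp, by rw [inv_div]⟩

lemma QPos.div {f g : RatFunc ℚ} (hf : QPos f) (hg : QPos g) : QPos (f / g) := by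
  rw [div_eq_mul_inv]; exact hf.mul hg.inv

lemma QPos.one : QPos 1 := ⟨1, 1, by simp, by simp, by simp⟩

lemma QPos.X : QPos RatFunc.X := ⟨Polynomial.X, 1, by simp, by simp, by simp⟩

lemma QPos.pow {f : RatFunc ℚ} (hf : QPos f) (n : ℕ) : QPos (f ^ n) := by
  induction n with
  | zero => simpa using QPos.one
  | succ n ih => rw [pow_succ]; exact ih.mul hf

lemma QPos.Xneg (n : ℕ) : QPos (RatFunc.X ^ (-(n : ℤ))) := by
  rw [zpow_neg, zpow_natCast]; exact (QPos.X.pow n).inv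

/-- Zero or positive at `q = 1`. -/
def QNN (f : RatFunc ℚ) : Prop := f = 0 ∨ QPos f

lemma QPos.add_nn {f g : RatFunc ℚ} (hf : QPos f) (hg : QNN g) : QPos (f + g) := by
  rcases hg with rfl | hg
  · simpa using hf
  · exact hf.add hg

lemma QPos.mul_nn {f g : RatFunc ℚ} (hf : QPos f) (hg : QNN g) : QNN (f * g) := by
  rcases hg with rfl | hg
  · left; simp
  · exact Or.inr (hf.mul hg)

lemma qF_succ (n : ℕ) : qF (n + 1) = qF n + RatFunc.X ^ n := by
  simp [qF, Finset.sum_range_succ]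

lemma qF_succ' (n : ℕ) : qF (n + 1) = 1 + RatFunc.X * qF n := by
  simp [qF, Finset.sum_range_succ', Finset.mul_sum, pow_succ', add_comm]

lemma qFinv_succ' (n : ℕ) : qFinv (n + 1) = 1 + RatFunc.X⁻¹ * qFinv n := by
  simp only [qFinv, zpow_neg, zpow_natCast]
  rw [Finset.sum_range_succ', Finset.mul_sum, add_comm]
  simp [pow_succ, mul_inv, mul_comm]

lemma qF_nn (n : ℕ) : QNN (qF n) := by
  induction n with
  | zero => left; simp [qF]
  | succ n ih => right; rw [qF_succ']; exact QPos.one.add_nn (QPos.X.mul_nn ih)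

lemma qF_pos {n : ℕ} (h : 0 < n) : QPos (qF n) := by
  obtain ⟨n, rfl⟩ := Nat.exists_eq_succ_of_ne_zero h.ne'
  rw [Nat.succ_eq_add_one, qF_succ']; exact QPos.one.add_nn (QPos.X.mul_nn (qF_nn n))

lemma qFinv_nn (n : ℕ) : QNN (qFinv n) := by
  induction n with
  | zero => left; simp [qFinv]
  | succ n ih => right; rw [qFinv_succ']; exact QPos.one.add_nn (QPos.X.inv.mul_nn ih)

lemma qFinv_pos {n : ℕ} (h : 0 < n) : QPos (qFinv n) := by
  obtain ⟨n, rfl⟩ := Nat.exists_eq_succ_of_ne_zero h.ne'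
  rw [Nat.succ_eq_add_one, qFinv_succ']
  exact QPos.one.add_nn (QPos.X.inv.mul_nn (qFinv_nn n))

/-- Inverse of the negative continued fraction. -/
noncomputable def ginv : List ℕ → RatFunc ℚ
  | [] => 0
  | c :: L => (qF c - RatFunc.X ^ (c - 1) * ginv L)⁻¹

/-- Inverse of the regular continued fraction. -/
noncomputable def rinv : ℕ → (ℕ → ℕ) → RatFunc ℚ
  | 0, _ => 0
  | m + 1, a => (qF (a 0) + RatFunc.X ^ (a 0) /
      (qFinv (a 1) + RatFunc.X ^ (-(a 1 : ℤ)) * rinv m (fun i => a (i + 2))))⁻¹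

/-- Blocks of the conversion after the first one. -/
def blocks : ℕ → (ℕ → ℕ) → List ℕ
  | 0, _ => []
  | m + 1, a => (a 0 + 2) :: (List.replicate (a 1 - 1) 2 ++ blocks m (fun i => a (i + 2)))

lemma blocks_eq (m : ℕ) (a : ℕ → ℕ) : blocks m a = ((List.range m).map fun j =>
    (a (2 * j) + 2) :: List.replicate (a (2 * j + 1) - 1) 2).flatten := by
  induction m generalizing a with
  | zero => simp [blocks]
  | succ m ih =>
    rw [blocks, ih, List.range_succ_eq_map]
    simp [Function.comp_def, Nat.mul_add, Nat.add_right_comm]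

lemma hirz_succ (m : ℕ) (a : ℕ → ℕ) : hirz (m + 1) a =
    (a 0 + 1) :: (List.replicate (a 1 - 1) 2 ++ blocks m (fun i => a (i + 2))) := by
  rw [hirz, blocks_eq, List.range_succ_eq_map]
  simp [Function.comp_def, Nat.mul_add, Nat.add_right_comm]

lemma blocks_ge (m : ℕ) (a : ℕ → ℕ) : ∀ c ∈ blocks m a, 2 ≤ c := by
  induction m generalizing a with
  | zero => simp [blocks]
  | succ m ih =>
    intro c hc
    simp only [blocks, List.mem_cons, List.mem_append, List.mem_replicate] at hc
    rcases hc with h | h | h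
    · omega
    · omega
    · exact ih _ _ h

lemma ginv_pos (L : List ℕ) (h : ∀ c ∈ L, 2 ≤ c) :
    QNN (ginv L) ∧ QPos (1 - ginv L) ∧ (L ≠ [] → QPos (ginv L)) := by
  induction L with
  | nil => exact ⟨Or.inl rfl, by simpa [ginv] using QPos.one, by simp⟩
  | cons c L ih =>
    obtain ⟨-, h2, -⟩ := ih (fun d hd => h d (by simp [hd]))
    obtain ⟨n, rfl⟩ : ∃ n, c = n + 2 := ⟨c - 2, by have := h c (by simp); omega⟩
    have hW : QPos (RatFunc.X * qF n + RatFunc.X ^ (n + 1) * (1 - ginv L)) := by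
      rw [add_comm]
      exact ((QPos.X.pow _).mul h2).add_nn (QPos.X.mul_nn (qF_nn n))
    have hV := QPos.one.add hW
    have e : ginv ((n + 2) :: L) =
        (1 + (RatFunc.X * qF n + RatFunc.X ^ (n + 1) * (1 - ginv L)))⁻¹ := by
      rw [ginv, qF_succ, qF_succ']
      congr 1
      simp only [show n + 2 - 1 = n + 1 from rfl]
      ring
    rw [e]
    refine ⟨Or.inr hV.inv, ?_, fun _ => hV.inv⟩
    convert hW.div hV using 1
    have := hV.ne_zero
    field_simp
    ring

lemma rinv_nn (m : ℕ) (a : ℕ → ℕ) (ha : ∀ i < 2 * m, 0 < a i) : QNN (rinv m a) := by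
  induction m generalizing a with
  | zero => exact Or.inl rfl
  | succ m ih =>
    right
    have h := ih (fun i => a (i + 2)) (fun i hi => ha _ (by omega))
    exact ((qF_pos (ha 0 (by omega))).add ((QPos.X.pow _).div
      ((qFinv_pos (ha 1 (by omega))).add_nn ((QPos.Xneg _).mul_nn h)))).inv

lemma twos (R : RatFunc ℚ) (hR : QNN R) (L : List ℕ)
    (hL : ginv L = R / (R + RatFunc.X)) (n : ℕ) :
    1 - ginv (List.replicate n 2 ++ L) =
      (qFinv (n + 1) + RatFunc.X ^ (-((n + 1 : ℕ) : ℤ)) * R)⁻¹ := by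
  have hX : (RatFunc.X : RatFunc ℚ) ≠ 0 := RatFunc.X_ne_zero
  induction n with
  | zero =>
    have h1 : RatFunc.X + R ≠ 0 := (QPos.X.add_nn hR).ne_zero
    have h2 : R + RatFunc.X ≠ 0 := by rwa [add_comm]
    simp only [List.replicate_zero, List.nil_append, hL, qFinv_succ']
    have h3 : qFinv 0 = 0 := by simp [qFinv]
    have e1 : 1 + RatFunc.X⁻¹ * 0 + (RatFunc.X ^ (0 + 1))⁻¹ * R = (R + RatFunc.X) / RatFunc.X := by
      field_simp
      ring
    rw [h3, zpow_neg, zpow_natCast, e1, inv_div]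
    field_simp
    ring
  | succ n ih =>
    have hD : QPos (qFinv (n + 1) + RatFunc.X ^ (-((n + 1 : ℕ) : ℤ)) * R) :=
      (qFinv_pos (by omega)).add_nn ((QPos.Xneg _).mul_nn hR)
    have e : qFinv (n + 1 + 1) + RatFunc.X ^ (-((n + 1 + 1 : ℕ) : ℤ)) * R =
        1 + RatFunc.X⁻¹ * (qFinv (n + 1) + RatFunc.X ^ (-((n + 1 : ℕ) : ℤ)) * R) := by
      rw [qFinv_succ' (n + 1)]
      simp only [zpow_neg, zpow_natCast, pow_succ, mul_inv]
      ring
    rw [e]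
    generalize qFinv (n + 1) + RatFunc.X ^ (-((n + 1 : ℕ) : ℤ)) * R = D at *
    rw [List.replicate_succ, List.cons_append, ginv]
    have e2 : ginv (List.replicate n 2 ++ L) = 1 - D⁻¹ := by rw [← ih]; ring
    have e3 : qF 2 = 1 + RatFunc.X := by simp [qF, Finset.sum_range_succ]
    rw [e2, e3]
    have h1 := hD.ne_zero
    have h2 : RatFunc.X + D ≠ 0 := (QPos.X.add hD).ne_zero
    have h4 : D + RatFunc.X ≠ 0 := by rwa [add_comm]
    have e4 : 1 + RatFunc.X - RatFunc.X ^ (2 - 1) * (1 - D⁻¹) = (D + RatFunc.X) / D := by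
      field_simp
      ring
    have e5 : 1 + RatFunc.X⁻¹ * D = (D + RatFunc.X) / RatFunc.X := by
      field_simp
      ring
    rw [e4, e5, inv_div, inv_div]
    field_simp
    ring

lemma ginv_blocks (m : ℕ) (a : ℕ → ℕ) (ha : ∀ i < 2 * m, 0 < a i) :
    ginv (blocks m a) = rinv m a / (rinv m a + RatFunc.X) := by
  induction m generalizing a with
  | zero => simp [blocks, ginv, rinv]
  | succ m ih =>
    have ha' : ∀ i < 2 * m, 0 < a (i + 2) := fun i hi => ha _ (by omega)
    have h := twos _ (rinv_nn m (fun i => a (i + 2)) ha') _ (ih (fun i => a (i + 2)) ha') (a 1 - 1)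
    rw [Nat.sub_add_cancel (ha 1 (by omega))] at h
    have hp : QPos (rinv (m + 1) a)⁻¹ := by
      rw [rinv, inv_inv]
      exact (qF_pos (ha 0 (by omega))).add ((QPos.X.pow _).div
        ((qFinv_pos (ha 1 (by omega))).add_nn ((QPos.Xneg _).mul_nn (rinv_nn m _ ha'))))
    have e : (rinv (m + 1) a)⁻¹ = qF (a 0) + RatFunc.X ^ (a 0) *
        (1 - ginv (List.replicate (a 1 - 1) 2 ++ blocks m (fun i => a (i + 2)))) := by
      rw [h, rinv, inv_inv, div_eq_mul_inv]
    rw [blocks, ginv]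
    have e2 : qF (a 0 + 2) - RatFunc.X ^ (a 0 + 2 - 1) *
        ginv (List.replicate (a 1 - 1) 2 ++ blocks m (fun i => a (i + 2)))
        = 1 + RatFunc.X * (rinv (m + 1) a)⁻¹ := by
      rw [e, qF_succ' (a 0 + 1), qF_succ (a 0), show a 0 + 2 - 1 = a 0 + 1 from rfl]
      ring
    rw [e2]
    have h0 : rinv (m + 1) a ≠ 0 := by simpa using hp.inv.ne_zero
    have h1 : 1 + RatFunc.X * (rinv (m + 1) a)⁻¹ = (rinv (m + 1) a + RatFunc.X) / rinv (m + 1) a := by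
      field_simp
    rw [h1, inv_div]

lemma ginv_hirz (m : ℕ) (a : ℕ → ℕ) (ha : ∀ i < 2 * (m + 1), 0 < a i) :
    ginv (hirz (m + 1) a) = rinv (m + 1) a := by
  have ha' : ∀ i < 2 * m, 0 < a (i + 2) := fun i hi => ha _ (by omega)
  have h := twos _ (rinv_nn m (fun i => a (i + 2)) ha') _
    (ginv_blocks m (fun i => a (i + 2)) ha') (a 1 - 1)
  rw [Nat.sub_add_cancel (ha 1 (by omega))] at h
  rw [hirz_succ, ginv, rinv, div_eq_mul_inv, ← h, qF_succ, Nat.add_sub_cancel]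
  congr 1
  ring

lemma x_eq (L : List ℕ) (x : ℕ → RatFunc ℚ)
    (hlast : L ≠ [] → x (L.length - 1) = qF (L.getD (L.length - 1) 0))
    (hrec : ∀ i, i + 1 < L.length →
      x i = qF (L.getD i 0) - RatFunc.X ^ (L.getD i 0 - 1) / x (i + 1)) :
    ∀ i < L.length, x i = (ginv (L.drop i))⁻¹ := by
  induction L generalizing x with
  | nil => simp
  | cons c L ih =>
    have key : ∀ i < L.length, x (i + 1) = (ginv (L.drop i))⁻¹ := by
      apply ih (fun i => x (i + 1))
      · intro hL
        have h1 : 0 < L.length := List.length_pos_iff.2 hL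
        have := hlast (by simp)
        obtain ⟨n, hn⟩ : ∃ n, L.length = n + 1 := ⟨L.length - 1, by omega⟩
        simpa [hn] using this
      · intro i hi
        simpa using hrec (i + 1) (by simpa using hi)
    intro i hi
    rcases i with _ | i
    · rcases L with _ | ⟨d, L⟩
      · simpa [ginv] using hlast
      · have h0 := hrec 0 (by simp)
        rw [key 0 (by simp)] at h0
        simp only [List.drop_zero, List.getD_cons_zero] at h0 ⊢
        rw [h0, div_inv_eq_mul, ginv.eq_2 c, inv_inv]
    · simpa using key i (by simpa using hi)

lemma y_eq (m : ℕ) (a : ℕ → ℕ) (ha : ∀ i < 2 * (m + 1), 0 < a i) (y : ℕ → RatFunc ℚ)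
    (hylast : y (2 * m + 1) = qFinv (a (2 * m + 1)))
    (hyrec : ∀ i, i + 1 < 2 * (m + 1) →
      y i = if i % 2 = 0 then qF (a i) + RatFunc.X ^ (a i) / y (i + 1)
            else qFinv (a i) + RatFunc.X ^ (-(a i : ℤ)) / y (i + 1)) :
    (∀ i < 2 * (m + 1), QPos (y i)) ∧ y 0 = (rinv (m + 1) a)⁻¹ := by
  induction m generalizing a y with
  | zero =>
    have h1 : y 1 = qFinv (a 1) := hylast
    have h0 : y 0 = qF (a 0) + RatFunc.X ^ (a 0) / y 1 := by simpa using hyrec 0 (by omega)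
    have p1 : QPos (y 1) := h1 ▸ qFinv_pos (ha 1 (by omega))
    have p0 : QPos (y 0) := h0 ▸ (qF_pos (ha 0 (by omega))).add ((QPos.X.pow _).div p1)
    refine ⟨?_, ?_⟩
    · intro i hi
      interval_cases i
      · exact p0
      · exact p1
    · simp [rinv, h0, h1]
  | succ m ih =>
    obtain ⟨hp, he⟩ := ih (fun i => a (i + 2)) (fun i hi => ha _ (by omega)) (fun i => y (i + 2))
      hylast (fun i hi => by
        have := hyrec (i + 2) (by omega)
        rwa [Nat.add_mod_right, show i + 2 + 1 = i + 1 + 2 by omega] at this)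
    have h0 : y 0 = qF (a 0) + RatFunc.X ^ (a 0) / y 1 := by simpa using hyrec 0 (by omega)
    have h1 : y 1 = qFinv (a 1) + RatFunc.X ^ (-(a 1 : ℤ)) / y 2 := by
      simpa using hyrec 1 (by omega)
    have p2 : QPos (y 2) := hp 0 (by omega)
    have p1 : QPos (y 1) := h1 ▸ (qFinv_pos (ha 1 (by omega))).add ((QPos.Xneg _).div p2)
    have p0 : QPos (y 0) := h0 ▸ (qF_pos (ha 0 (by omega))).add ((QPos.X.pow _).div p1)
    refine ⟨?_, ?_⟩
    · intro i hi
      rcases i with _ | _ | i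
      · exact p0
      · exact p1
      · exact hp i (by omega)
    · have he' : y 2 = (rinv (m + 1) (fun i => a (i + 2)))⁻¹ := he
      rw [h0, h1, he', div_inv_eq_mul, rinv.eq_2 a (m + 1), inv_inv]

/-- for `m ≥ 1`, positive integers `a_1,…,a_{2m}` (0-indexed) and
`(c_1,…,c_k)` the Hirzebruch conversion of `(a_1,…,a_{2m})`, the `q`-deformed regular
continued fraction of the `a_i` equals the `q`-deformed negative continued fraction of
the `c_i`, and all intermediate tails of both continued fractions are nonzero. -/
theorem regular_eq_negative_cf (m : ℕ) (hm : 1 ≤ m) (a : ℕ → ℕ)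
    (ha : ∀ i < 2 * m, 0 < a i)
    (k : ℕ) (hk : k = (hirz m a).length)
    (c : ℕ → ℕ) (hc : ∀ i < k, c i = (hirz m a).getD i 0)
    (y x : ℕ → RatFunc ℚ)
    (hylast : y (2 * m - 1) = qFinv (a (2 * m - 1)))
    (hyrec : ∀ i, i + 1 < 2 * m →
      y i = if i % 2 = 0 then qF (a i) + RatFunc.X ^ (a i) / y (i + 1)
            else qFinv (a i) + RatFunc.X ^ (-(a i : ℤ)) / y (i + 1))
    (hxlast : x (k - 1) = qF (c (k - 1)))
    (hxrec : ∀ i, i + 1 < k → x i = qF (c i) - RatFunc.X ^ (c i - 1) / x (i + 1)) :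
    (∀ i < 2 * m, y i ≠ 0) ∧ (∀ i < k, x i ≠ 0) ∧ y 0 = x 0 := by
  obtain ⟨m, rfl⟩ : ∃ n, m = n + 1 := ⟨m - 1, by omega⟩
  obtain ⟨hy, hy0⟩ := y_eq m a ha y hylast hyrec
  have hne : hirz (m + 1) a ≠ [] := by rw [hirz_succ]; simp
  have hkpos : 0 < k := hk ▸ List.length_pos_iff.2 hne
  have hge : ∀ c ∈ hirz (m + 1) a, 2 ≤ c := by
    intro c hc
    rw [hirz_succ] at hc
    simp only [List.mem_cons, List.mem_append, List.mem_replicate] at hc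
    have := ha 0 (by omega)
    rcases hc with h | h | h
    · omega
    · omega
    · exact blocks_ge _ _ _ h
  have hx := x_eq (hirz (m + 1) a) x
    (fun _ => by rw [← hk, ← hc _ (by omega)]; exact hxlast)
    (fun i hi => by rw [← hc _ (by omega)]; exact hxrec i (by omega))
  refine ⟨fun i hi => (hy i hi).ne_zero, fun i hi => ?_, ?_⟩
  · rw [hx i (by omega)]
    refine ((ginv_pos _ (fun d hd => hge d (List.mem_of_mem_drop hd))).2.2 ?_).inv.ne_zero
    simp only [ne_eq, List.drop_eq_nil_iff]
    omega
  · rw [hx 0 (by omega), hy0, List.drop_zero, ginv_hirz m a ha]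
end

section
/- Let m ≥ 1, let a_1,…,a_{2m} be positive integers, and let (c_1,…,c_k) be the Hirzebruch conversion of (a_1,…,a_{2m}). Then, as 2×2 matrices over ℤ[q,q⁻¹] (embedding ℤ[q] canonically), M^+(a_1,…,a_{2m})_q = M(c_1,…,c_k)_q · R_q, where R_q = [[q, 1], [0, 1]]. -/
open LaurentPolynomial in
/-- The elementary Laurent factor. -/
noncomputable def LL (c : ℕ) : Matrix (Fin 2) (Fin 2) (LaurentPolynomial ℤ) :=
  !![qLp c, -(T ((c - 1 : ℕ) : ℤ)); 1, 0]

open LaurentPolynomial in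
/-- The matrix `R_q`. -/
noncomputable def RR : Matrix (Fin 2) (Fin 2) (LaurentPolynomial ℤ) :=
  !![(T 1 : LaurentPolynomial ℤ), 1; 0, 1]

open LaurentPolynomial in
theorem qLp_succ (n : ℕ) : qLp (n + 1) = qLp n + T (n : ℤ) := by
  simp [qLp, Finset.sum_range_succ]

open LaurentPolynomial in
theorem qLp_succ' (n : ℕ) : qLp (n + 1) = T 1 * qLp n + 1 := by
  simp only [qLp, Finset.sum_range_succ', Finset.mul_sum, ← T_add]
  simp [add_comm]

open LaurentPolynomial in
theorem qLm_mul (n : ℕ) : T (n : ℤ) * qLm n = T 1 * qLp n := by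
  induction n with
  | zero => simp [qLm, qLp]
  | succ n ih =>
    have h : qLm (n + 1) = qLm n + T (-(n : ℤ)) := by
      simp [qLm, Finset.sum_range_succ]
    rw [h, qLp_succ', mul_add, ← T_add]
    have h2 : (T ((n + 1 : ℕ) : ℤ) : LaurentPolynomial ℤ) = T 1 * T (n : ℤ) := by
      rw [← T_add]; congr 1; push_cast; ring
    rw [h2, mul_assoc, ih]
    have h3 : (((n + 1 : ℕ) : ℤ) + -(n : ℤ)) = 1 := by push_cast; ring
    rw [h3]; ring

open LaurentPolynomial in
theorem RR_LL (a : ℕ) : RR * LL (a + 1) = LL (a + 2) := by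
  have h : (T ((a + 1 : ℕ) : ℤ) : LaurentPolynomial ℤ) = T 1 * T (a : ℤ) := by
    rw [← T_add]; congr 1; push_cast; ring
  have e : a + 2 - 1 = a + 1 := rfl
  simp only [RR, LL, Matrix.mul_fin_two, qLp_succ' (a + 1), Nat.add_sub_cancel, e, h]
  generalize (T (a : ℤ) : LaurentPolynomial ℤ) = t
  generalize (T 1 : LaurentPolynomial ℤ) = q
  generalize qLp (a + 1) = u
  refine Matrix.ext fun i j => ?_
  fin_cases i <;> fin_cases j <;> simp

open LaurentPolynomial in
theorem LL_two_pow (n : ℕ) : LL 2 ^ n * RR = !![T 1 * qLp (n + 1), 1; T 1 * qLp n, 1] := by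
  induction n with
  | zero => simp [RR, qLp]
  | succ n ih =>
    have h2 : qLp 2 = 1 + (T 1 : LaurentPolynomial ℤ) := by
      simp [qLp, Finset.sum_range_succ]
    rw [pow_succ', mul_assoc, ih, LL, Matrix.mul_fin_two, qLp_succ' (n + 1), qLp_succ' n, h2]
    have e1 : (T ((2 - 1 : ℕ) : ℤ) : LaurentPolynomial ℤ) = T 1 := rfl
    rw [e1]
    generalize (T 1 : LaurentPolynomial ℤ) = q
    generalize qLp n = u
    refine Matrix.ext fun i j => ?_
    fin_cases i <;> fin_cases j <;> simp <;> ring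

open LaurentPolynomial in
theorem block_eq (x b : ℕ) (hb : 0 < b) :
    (T (b : ℤ) : LaurentPolynomial ℤ) •
      (!![qLp x, T ((x : ℤ)); 1, 0] * !![qLm b, T (-(b : ℤ)); 1, 0]) =
    LL (x + 1) * LL 2 ^ (b - 1) * RR := by
  obtain ⟨n, rfl⟩ : ∃ n, b = n + 1 := ⟨b - 1, by omega⟩
  have h1 := qLm_mul (n + 1)
  have h2 : (T ((n + 1 : ℕ) : ℤ) * T (-((n + 1 : ℕ) : ℤ)) : LaurentPolynomial ℤ) = 1 := by
    rw [← T_add, add_neg_cancel, T_zero]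
  have h3 : (T ((n + 1 : ℕ) : ℤ) : LaurentPolynomial ℤ) = T 1 * T (n : ℤ) := by
    rw [← T_add]; congr 1; push_cast; ring
  have h4 := qLp_succ n
  have h5 := qLp_succ x
  rw [mul_assoc, Nat.add_sub_cancel, LL_two_pow, LL, Matrix.mul_fin_two, Matrix.mul_fin_two,
    Nat.add_sub_cancel]
  generalize (T ((n + 1 : ℕ) : ℤ) : LaurentPolynomial ℤ) = t at *
  generalize (T (-((n + 1 : ℕ) : ℤ)) : LaurentPolynomial ℤ) = t' at *
  generalize qLm (n + 1) = u at *
  generalize qLp (n + 1) = v at *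
  generalize (T (n : ℤ) : LaurentPolynomial ℤ) = w at *
  generalize (T (x : ℤ) : LaurentPolynomial ℤ) = z at *
  generalize (T 1 : LaurentPolynomial ℤ) = q at *
  refine Matrix.ext fun i j => ?_
  fin_cases i <;> fin_cases j <;> simp
  · rw [h5]; linear_combination qLp x * h1 + z * h3 - q * z * h4
  · rw [h5]; linear_combination qLp x * h2
  · exact h1
  · exact h2

open LaurentPolynomial in
theorem Mmat_map (l : List ℕ) :
    (Mmat l.length (fun i => l.getD i 0)).map Polynomial.toLaurent = (l.map LL).prod := by
  have h : ∀ c, (!![qN c, -(Polynomial.X ^ (c - 1)); 1, 0] :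
      Matrix (Fin 2) (Fin 2) (Polynomial ℤ)).map Polynomial.toLaurent = LL c := by
    intro c
    ext i j
    fin_cases i <;> fin_cases j <;> simp [LL, qN, qLp]
  have e : (List.range l.length).map (fun i => l.getD i 0) = l := by
    apply List.ext_getElem
    · simp
    · intro i h1 h2
      simp [h2]
  have key : Mmat l.length (fun i => l.getD i 0) =
      (l.map fun c => (!![qN c, -(Polynomial.X ^ (c - 1)); 1, 0] :
      Matrix (Fin 2) (Fin 2) (Polynomial ℤ))).prod := by
    conv_rhs => rw [← e, List.map_map]
    rfl
  rw [key]
  have := map_list_prod (RingHom.mapMatrix (m := Fin 2)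
    (Polynomial.toLaurent : Polynomial ℤ →+* LaurentPolynomial ℤ))
    (l.map fun c => (!![qN c, -(Polynomial.X ^ (c - 1)); 1, 0] :
      Matrix (Fin 2) (Fin 2) (Polynomial ℤ)))
  rw [RingHom.mapMatrix_apply] at this
  rw [this, List.map_map]
  congr 1
  apply List.map_congr_left
  intro c _
  exact h c

open LaurentPolynomial in
theorem Mplus_succ (m : ℕ) (a : ℕ → ℕ) (hb : 0 < a (2 * m + 1)) :
    Mplus (m + 1) a = Mplus m a * (LL (a (2 * m) + 1) * LL 2 ^ (a (2 * m + 1) - 1) * RR) := by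
  rw [← block_eq _ _ hb]
  have e : 2 * (m + 1) = 2 * m + 1 + 1 := by ring
  have o : ¬ (2 * m + 1) % 2 = 0 := by omega
  have z : (2 * m) % 2 = 0 := by omega
  rw [Mplus, Mplus, e, List.range_succ, List.range_succ, Ksum, Finset.sum_range_succ, T_add, ← Ksum]
  simp only [List.map_append, List.prod_append, List.map_cons, List.map_nil, List.prod_cons,
    List.prod_nil, mul_one, MplusF, o, z, if_true, if_false]
  rw [Matrix.smul_mul, Matrix.mul_smul, smul_smul, mul_assoc]

theorem hirz_prod (m : ℕ) (a : ℕ → ℕ) :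
    ((hirz (m + 1) a).map LL).prod = ((hirz m a).map LL).prod *
      (LL (if m = 0 then a 0 + 1 else a (2 * m) + 2) * LL 2 ^ (a (2 * m + 1) - 1)) := by
  simp [hirz, List.range_succ]

theorem main_aux (m : ℕ) (a : ℕ → ℕ) (ha : ∀ i < 2 * (m + 1), 0 < a i) :
    Mplus (m + 1) a = ((hirz (m + 1) a).map LL).prod * RR := by
  induction m with
  | zero =>
    rw [Mplus_succ _ _ (ha _ (by omega)), hirz_prod]
    simp [Mplus, Ksum, hirz]
  | succ m ih =>
    rw [Mplus_succ _ _ (ha _ (by omega)), hirz_prod, ih (fun i hi => ha i (by omega)),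
      if_neg (by omega), ← RR_LL (a (2 * (m + 1)))]
    simp only [mul_assoc]

open LaurentPolynomial in
/-- with `(c_1,…,c_k)` the Hirzebruch conversion of `(a_1,…,a_{2m})`,
`M^+(a_1,…,a_{2m})_q = M(c_1,…,c_k)_q · R_q` where `R_q = [[q, 1], [0, 1]]`,
as matrices over `ℤ[q,q⁻¹]`. -/
theorem Mplus_eq_M_hirzebruch_mul_R (m : ℕ) (hm : 1 ≤ m) (a : ℕ → ℕ)
    (ha : ∀ i < 2 * m, 0 < a i) :
    Mplus m a =
      (Mmat (hirz m a).length (fun i => (hirz m a).getD i 0)).map Polynomial.toLaurent *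
        !![(T 1 : LaurentPolynomial ℤ), 1; 0, 1] := by
  obtain ⟨n, rfl⟩ : ∃ n, m = n + 1 := ⟨m - 1, by omega⟩
  rw [Mmat_map]
  exact main_aux n a ha
end

section
/- For every k ≥ 1 and positive integers c_1,…,c_k, reversing the sequence of parameters does not change the trace: Tr M(c_1,…,c_k)_q = Tr M(c_k,…,c_1)_q in ℤ[q]. -/
/-- The symmetrizing matrix. -/
noncomputable def Ssym : Matrix (Fin 2) (Fin 2) (Polynomial ℤ) :=
  !![-1, Polynomial.X - 1; Polynomial.X - 1, Polynomial.X]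

theorem Ssym_comm (c : ℕ) (hc : 0 < c) :
    !![qN c, -(Polynomial.X ^ (c - 1)); 1, 0] * Ssym =
      Ssym * (!![qN c, -(Polynomial.X ^ (c - 1)); 1, 0] : Matrix _ _ _).transpose := by
  obtain ⟨n, rfl⟩ : ∃ n, c = n + 1 := ⟨c - 1, by omega⟩
  have h : qN (n + 1) * (Polynomial.X - 1) = Polynomial.X ^ (n + 1) - 1 := geom_sum_mul _ _
  ext1 i j
  fin_cases i <;> fin_cases j <;> simp [Ssym, Matrix.mul_apply, Fin.sum_univ_two]
  all_goals first | ring1 | (linear_combination (norm := ring1) h) | (linear_combination (norm := ring1) -h)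

theorem Ssym_list (l : List (Matrix (Fin 2) (Fin 2) (Polynomial ℤ)))
    (h : ∀ A ∈ l, A * Ssym = Ssym * A.transpose) :
    l.prod * Ssym = Ssym * l.reverse.prod.transpose := by
  induction l with
  | nil => simp
  | cons A l ih =>
    have h1 := ih (fun B hB => h B (List.mem_cons_of_mem _ hB))
    have h2 := h A List.mem_cons_self
    simp only [List.prod_cons, List.reverse_cons, List.prod_append, List.prod_nil, mul_one,
      Matrix.transpose_mul]
    rw [mul_assoc, h1, ← mul_assoc, h2, mul_assoc]

theorem Ssym_det : Ssym.det ≠ 0 := by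
  intro h
  have := congrArg (Polynomial.eval 0) h
  simp [Ssym, Matrix.det_fin_two] at this

/-- for `k ≥ 1` and positive integers `c_1,…,c_k`,
`Tr M(c_1,…,c_k)_q = Tr M(c_k,…,c_1)_q` in `ℤ[q]`. -/
theorem trace_M_reverse (k : ℕ) (hk : 1 ≤ k) (c : ℕ → ℕ) (hc : ∀ i < k, 0 < c i) :
    Matrix.trace (Mmat k c) = Matrix.trace (Mmat k (fun i => c (k - 1 - i))) := by
  have hrev : Mmat k (fun i => c (k - 1 - i)) =
      ((List.range k).map fun i =>
        !![qN (c i), -(Polynomial.X ^ (c i - 1)); 1, 0]).reverse.prod := by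
    unfold Mmat
    congr 1
    apply List.ext_getElem
    · simp
    · intro i h1 h2
      simp
  have key := Ssym_list ((List.range k).map fun i =>
      !![qN (c i), -(Polynomial.X ^ (c i - 1)); 1, 0]) (by
    intro A hA
    obtain ⟨i, hi, rfl⟩ := List.mem_map.1 hA
    exact Ssym_comm _ (hc i (List.mem_range.1 hi)))
  rw [← hrev] at key
  change Mmat k c * Ssym = _ at key
  have h2 := congrArg (fun B => Matrix.trace (B * Ssym.adjugate)) key
  rw [mul_assoc, Matrix.mul_adjugate, Matrix.trace_mul_comm (Ssym * _), ← mul_assoc,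
    Matrix.adjugate_mul] at h2
  simp only [mul_smul_comm, smul_mul_assoc, mul_one, one_mul, Matrix.trace_smul,
    Matrix.trace_transpose, smul_eq_mul] at h2
  exact mul_left_cancel₀ Ssym_det h2
end

section
/- For every m ≥ 1 and positive integers a_1,…,a_{2m}, reversing the sequence of parameters does not change the trace: Tr M^+(a_1,…,a_{2m})_q = Tr M^+(a_{2m},…,a_1)_q in ℤ[q,q⁻¹]. -/
open LaurentPolynomial in
lemma qLm_eq (c : ℕ) : (T (c : ℤ) : LaurentPolynomial ℤ) * qLm c = T 1 * qLp c := by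
  unfold qLm qLp
  rw [← Finset.sum_range_reflect, Finset.mul_sum, Finset.mul_sum]
  refine Finset.sum_congr rfl fun i hi => ?_
  have hi' := Finset.mem_range.1 hi
  rw [← T_add, ← T_add]
  congr 1
  omega

open LaurentPolynomial in
/-- The product of two consecutive normalised factors. -/
noncomputable def pairN (b c : ℕ) : Matrix (Fin 2) (Fin 2) (LaurentPolynomial ℤ) :=
  !![T 1 * qLp b * qLp c + T ((b : ℤ) + c), qLp b; T 1 * qLp c, 1]

open LaurentPolynomial in
lemma pairN_eq (b c : ℕ) :
    (T (c : ℤ) : LaurentPolynomial ℤ) •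
      (!![qLp b, T (b : ℤ); 1, 0] * !![qLm c, T (-(c : ℤ)); 1, 0]) = pairN b c := by
  have h := qLm_eq c
  have h2 : (T (c : ℤ) : LaurentPolynomial ℤ) * T (-(c : ℤ)) = 1 := by
    rw [← T_add, add_neg_cancel, T_zero]
  unfold pairN
  rw [T_add]
  generalize (T (-(c : ℤ)) : LaurentPolynomial ℤ) = u at *
  generalize (T (c : ℤ) : LaurentPolynomial ℤ) = v at *
  generalize (T (b : ℤ) : LaurentPolynomial ℤ) = w at *
  generalize (T 1 : LaurentPolynomial ℤ) = t at *
  ext1 i j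
  fin_cases i <;> fin_cases j <;> simp [Matrix.mul_apply, Fin.sum_univ_two]
  · linear_combination qLp b * h
  · linear_combination qLp b * h2
  · linear_combination h
  · linear_combination h2

open LaurentPolynomial in
lemma Mplus_eq (m : ℕ) (a : ℕ → ℕ) :
    Mplus m a = ((List.range m).map fun j => pairN (a (2 * j)) (a (2 * j + 1))).prod := by
  induction m with
  | zero => simp [Mplus, Ksum]
  | succ m ih =>
    rw [List.range_succ, List.map_append, List.prod_append, ← ih]
    simp only [List.map_cons, List.map_nil, List.prod_singleton]
    rw [← pairN_eq]
    unfold Mplus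
    rw [show 2 * (m + 1) = 2 * m + 1 + 1 by ring, List.range_succ, List.range_succ]
    simp only [List.map_append, List.prod_append, List.map_cons, List.map_nil,
      List.prod_singleton]
    have h0 : MplusF a (2 * m) = !![qLp (a (2 * m)), T (a (2 * m) : ℤ); 1, 0] := by
      simp [MplusF]
    have h1 : MplusF a (2 * m + 1) =
        !![qLm (a (2 * m + 1)), T (-(a (2 * m + 1) : ℤ)); 1, 0] := by
      unfold MplusF
      rw [if_neg (by omega)]
    have hk : Ksum (m + 1) a = Ksum m a + (a (2 * m + 1) : ℤ) := by
      simp [Ksum, Finset.sum_range_succ]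
    rw [h0, h1, hk, T_add, smul_mul_smul_comm, mul_assoc]

open LaurentPolynomial in
lemma pairN_flip (b c : ℕ) :
    !![T 1, 0; 0, 1] * pairN c b = (pairN b c).transpose * !![T 1, 0; 0, 1] := by
  unfold pairN
  rw [add_comm (c : ℤ)]
  ext1 i j
  fin_cases i <;> fin_cases j <;> simp [Matrix.mul_apply, Fin.sum_univ_two]
  · rw [mul_comm]
    left
    ring
  all_goals ring

lemma prod_flip {R : Type*} [CommRing R] (P : Matrix (Fin 2) (Fin 2) R)
    (X Y : ℕ → Matrix (Fin 2) (Fin 2) R) (h : ∀ j, P * Y j = (X j).transpose * P) (m : ℕ) :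
    P * ((List.range m).map fun j => Y (m - 1 - j)).prod =
      ((List.range m).map X).prod.transpose * P := by
  induction m with
  | zero => simp
  | succ m ih =>
    rw [List.range_succ_eq_map, List.map_cons, List.prod_cons, List.map_map,
      ← List.range_succ_eq_map, List.range_succ, List.map_append, List.prod_append,
      Matrix.transpose_mul]
    have e : ((fun j => Y (m + 1 - 1 - j)) ∘ Nat.succ) = fun j => Y (m - 1 - j) := by
      funext j
      simp only [Function.comp]
      congr 1
      omega
    rw [e, ← mul_assoc]
    simp only [Nat.add_sub_cancel, Nat.sub_zero, List.map_cons, List.map_nil,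
      List.prod_singleton]
    rw [h, mul_assoc, ih, mul_assoc]

/-- for `m ≥ 1` and positive integers `a_1,…,a_{2m}`,
`Tr M^+(a_1,…,a_{2m})_q = Tr M^+(a_{2m},…,a_1)_q` in `ℤ[q,q⁻¹]`. -/
theorem trace_Mplus_reverse (m : ℕ) (hm : 1 ≤ m) (a : ℕ → ℕ) (ha : ∀ i < 2 * m, 0 < a i) :
    Matrix.trace (Mplus m a) = Matrix.trace (Mplus m (fun i => a (2 * m - 1 - i))) := by
  rw [Mplus_eq, Mplus_eq]
  have key := prod_flip !![LaurentPolynomial.T 1, 0; 0, 1]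
    (fun j => pairN (a (2 * j)) (a (2 * j + 1))) (fun j => pairN (a (2 * j + 1)) (a (2 * j)))
    (fun j => pairN_flip _ _) m
  have e : ((List.range m).map fun j => pairN (a (2 * m - 1 - 2 * j))
        (a (2 * m - 1 - (2 * j + 1)))) =
      (List.range m).map fun j => pairN (a (2 * (m - 1 - j) + 1)) (a (2 * (m - 1 - j))) := by
    refine List.map_congr_left fun j hj => ?_
    have hj' := List.mem_range.1 hj
    congr 2 <;> omega
  rw [e]
  set Y := ((List.range m).map fun j =>
    pairN (a (2 * (m - 1 - j) + 1)) (a (2 * (m - 1 - j)))).prod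
  set X := ((List.range m).map fun j => pairN (a (2 * j)) (a (2 * j + 1))).prod
  have hT : (!![LaurentPolynomial.T 1, 0; 0, 1] :
      Matrix (Fin 2) (Fin 2) (LaurentPolynomial ℤ)) *
      !![LaurentPolynomial.T (-1), 0; 0, 1] = 1 := by
    have h1 : (LaurentPolynomial.T 1 : LaurentPolynomial ℤ) * LaurentPolynomial.T (-1) = 1 := by
      rw [← LaurentPolynomial.T_add, add_neg_cancel, LaurentPolynomial.T_zero]
    rw [Matrix.mul_fin_two, h1, Matrix.one_fin_two]
    simp only [mul_zero, zero_mul, add_zero, zero_add, mul_one]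
  have hX : X.transpose = !![LaurentPolynomial.T 1, 0; 0, 1] * Y *
      !![LaurentPolynomial.T (-1), 0; 0, 1] := by
    rw [key, mul_assoc, hT, mul_one]
  rw [← Matrix.trace_transpose X, hX, Matrix.trace_mul_comm, ← mul_assoc,
    mul_eq_one_comm.1 hT, one_mul]
end

section
/- (Cyclic q-deformed Euler–Minding formula) For every k ≥ 3 and positive integers c_1,…,c_k (indices read modulo k), the q-rotundus satisfies Tr M(c_1,…,c_k)_q = Σ_S (∏_{i∈S} (−q^{c_i−1})) · (∏_{j ∉ S ∪ (S+1)} [c_j]_q), where the sum runs over all subsets S ⊆ ℤ/kℤ such that no two cyclically adjacent indices belong to S (i.e., for no i ∈ S is i+1 mod k ∈ S), S+1 = {i+1 mod k : i ∈ S}, and the second product runs over j ∈ ℤ/kℤ not lying in S ∪ (S+1). -/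
open Finset in
/-- weight of a set `S` in the linear chain with set `I` of initially blocked sites -/
noncomputable def emW (a b : ℕ → Polynomial ℤ) (n : ℕ) (I S : Finset ℕ) : Polynomial ℤ :=
  (∏ i ∈ S, b i) * ∏ j ∈ range n \ (S ∪ (I ∪ S.image (fun i => i + 1))), a j

open Finset in
/-- sum over admissible `S` ending in state 0 -/
noncomputable def emF0 (a b : ℕ → Polynomial ℤ) (n : ℕ) (I : Finset ℕ) : Polynomial ℤ :=
  ∑ S ∈ (range n).powerset,
    if (∀ i ∈ S, i ∉ I ∪ S.image (fun i => i + 1)) ∧ n ∉ I ∪ S.image (fun i => i + 1)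
    then emW a b n I S else 0

open Finset in
/-- sum over admissible `S` ending in state 1 -/
noncomputable def emF1 (a b : ℕ → Polynomial ℤ) (n : ℕ) (I : Finset ℕ) : Polynomial ℤ :=
  ∑ S ∈ (range n).powerset,
    if (∀ i ∈ S, i ∉ I ∪ S.image (fun i => i + 1)) ∧ n ∈ I ∪ S.image (fun i => i + 1)
    then emW a b n I S else 0

open Finset in
theorem emW_insert (a b : ℕ → Polynomial ℤ) (n : ℕ) (I S : Finset ℕ) (hS : S ⊆ range n) :
    emW a b (n + 1) I (insert n S) = emW a b n I S * b n := by
  have hn : n ∉ S := fun h => by simpa using hS h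
  unfold emW
  rw [prod_insert hn]
  have : range (n + 1) \ (insert n S ∪ (I ∪ (insert n S).image (fun i => i + 1)))
      = range n \ (S ∪ (I ∪ S.image (fun i => i + 1))) := by
    ext j
    simp only [mem_sdiff, mem_range, mem_union, mem_insert, mem_image]
    grind
  rw [this]; ring

open Finset in
theorem emW_out (a b : ℕ → Polynomial ℤ) (n : ℕ) (I S : Finset ℕ) (hS : S ⊆ range n)
    (h : n ∉ I ∪ S.image (fun i => i + 1)) :
    emW a b (n + 1) I S = emW a b n I S * a n := by
  have hn : n ∉ S := fun h => by simpa using hS h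
  unfold emW
  have : range (n + 1) \ (S ∪ (I ∪ S.image (fun i => i + 1)))
      = insert n (range n \ (S ∪ (I ∪ S.image (fun i => i + 1)))) := by
    ext j
    simp only [mem_sdiff, mem_range, mem_union, mem_insert, mem_image] at *
    grind
  rw [this, prod_insert (by simp)]; ring

open Finset in
theorem emW_in (a b : ℕ → Polynomial ℤ) (n : ℕ) (I S : Finset ℕ)
    (h : n ∈ I ∪ S.image (fun i => i + 1)) :
    emW a b (n + 1) I S = emW a b n I S := by
  unfold emW
  have : range (n + 1) \ (S ∪ (I ∪ S.image (fun i => i + 1)))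
      = (range n \ (S ∪ (I ∪ S.image (fun i => i + 1)))) := by
    ext j
    simp only [mem_sdiff, mem_range, mem_union, mem_insert, mem_image] at *
    grind
  rw [this]

open Finset in
theorem emF0_succ (a b : ℕ → Polynomial ℤ) (n : ℕ) (I : Finset ℕ) (hI : I ⊆ {0}) :
    emF0 a b (n + 1) I = emF0 a b n I * a n + emF1 a b n I := by
  unfold emF0 emF1
  rw [range_add_one, sum_powerset_insert (by simp), sum_mul, ← sum_add_distrib,
    ← sum_add_distrib]
  refine sum_congr rfl fun S hS => ?_
  rw [mem_powerset] at hS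
  have h1 : n + 1 ∈ I ∪ (insert n S).image (fun i => i + 1) := by simp
  have h2 : n + 1 ∉ I ∪ S.image (fun i => i + 1) := by
    simp only [mem_union, mem_image, not_or, not_exists]
    refine ⟨fun h => by simpa using hI h, fun x hx => ?_⟩
    have := mem_range.1 (hS hx.1)
    omega
  by_cases g : n ∈ I ∪ S.image (fun i => i + 1)
  · simp [h1, h2, g, emW_in a b n I S g]
  · simp [h1, h2, g, emW_out a b n I S hS g]

open Finset in
theorem emF1_succ (a b : ℕ → Polynomial ℤ) (n : ℕ) (I : Finset ℕ) (hI : I ⊆ {0}) :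
    emF1 a b (n + 1) I = emF0 a b n I * b n := by
  unfold emF0 emF1
  rw [range_add_one, sum_powerset_insert (by simp), sum_mul, ← sum_add_distrib]
  refine sum_congr rfl fun S hS => ?_
  rw [mem_powerset] at hS
  have h1 : n + 1 ∈ I ∪ (insert n S).image (fun i => i + 1) := by simp
  have h2 : n + 1 ∉ I ∪ S.image (fun i => i + 1) := by
    simp only [mem_union, mem_image, not_or, not_exists]
    refine ⟨fun h => by simpa using hI h, fun x hx => ?_⟩
    have := mem_range.1 (hS hx.1)
    omega
  have h3 : (∀ i ∈ insert n S, i ∉ I ∪ (insert n S).image (fun i => i + 1)) ↔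
      (∀ i ∈ S, i ∉ I ∪ S.image (fun i => i + 1)) ∧ n ∉ I ∪ S.image (fun i => i + 1) := by
    have hS' : ∀ i ∈ S, i < n := fun i hi => mem_range.1 (hS hi)
    simp only [mem_union, mem_image, mem_insert]
    grind
  rw [if_neg (fun h => h2 h.2), zero_add, emW_insert a b n I S hS]
  simp only [h1, and_true, h3, ite_mul, zero_mul]

theorem emM (c : ℕ → ℕ) (n : ℕ) :
    Mmat n c = !![emF0 (fun i => qN (c i)) (fun i => -(Polynomial.X ^ (c i - 1))) n ∅,
      emF1 (fun i => qN (c i)) (fun i => -(Polynomial.X ^ (c i - 1))) n ∅;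
      emF0 (fun i => qN (c i)) (fun i => -(Polynomial.X ^ (c i - 1))) n {0},
      emF1 (fun i => qN (c i)) (fun i => -(Polynomial.X ^ (c i - 1))) n {0}] := by
  induction n with
  | zero => simp [Mmat, emF0, emF1, emW, Matrix.one_fin_two]
  | succ n ih =>
    have : Mmat (n + 1) c = Mmat n c * !![qN (c n), -(Polynomial.X ^ (c n - 1)); 1, 0] := by
      simp [Mmat, List.range_succ]
    rw [this, ih, emF0_succ _ _ _ _ (by simp), emF0_succ _ _ _ _ (by simp),
      emF1_succ _ _ _ _ (by simp), emF1_succ _ _ _ _ (by simp), Matrix.mul_fin_two]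
    simp

/-- cyclic q-deformed Euler–Minding formula: for `k ≥ 3` and positive
integers `c_1,…,c_k` with indices read modulo `k` (0-indexed: subsets `S ⊆ {0,…,k−1}`
with no two cyclically adjacent elements, `S+1` taken mod `k`),
`Tr M(c_1,…,c_k)_q = Σ_S (∏_{i∈S} (−q^{c_i−1})) · (∏_{j ∉ S ∪ (S+1)} [c_j]_q)`. -/
theorem rotundus_cyclic_euler_minding (k : ℕ) (hk : 3 ≤ k) (c : ℕ → ℕ)
    (hc : ∀ i < k, 0 < c i) :
    Matrix.trace (Mmat k c) =
      ∑ S ∈ (Finset.range k).powerset.filter (fun S => ∀ i ∈ S, (i + 1) % k ∉ S),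
        (∏ i ∈ S, -(Polynomial.X ^ (c i - 1))) *
          ∏ j ∈ Finset.range k \ (S ∪ S.image (fun i => (i + 1) % k)), qN (c j) := by
  rw [emM, Matrix.trace_fin_two_of, emF0, emF1, ← Finset.sum_add_distrib, Finset.sum_filter]
  refine Finset.sum_congr rfl fun S hS => ?_
  rw [Finset.mem_powerset] at hS
  have hS' : ∀ i ∈ S, i < k := fun i hi => Finset.mem_range.1 (hS hi)
  have hm : ∀ i ∈ S, (i + 1 = k ∧ (i + 1) % k = 0) ∨ (i + 1 < k ∧ (i + 1) % k = i + 1) := by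
    intro i hi
    rcases Nat.lt_or_ge (i + 1) k with h | h
    · exact Or.inr ⟨h, Nat.mod_eq_of_lt h⟩
    · have : i + 1 = k := by have := hS' i hi; omega
      exact Or.inl ⟨this, by rw [this, Nat.mod_self]⟩
  have key : ∀ I : Finset ℕ, (∀ x, x ∈ I ↔ x = 0 ∧ k - 1 ∈ S) → ∀ j < k,
      (j ∈ I ∪ S.image (fun i => i + 1) ↔ j ∈ S.image (fun i => (i + 1) % k)) := by
    intro I hI j hj
    simp only [Finset.mem_union, Finset.mem_image, hI]
    constructor
    · rintro (⟨rfl, h⟩ | ⟨i, hi, rfl⟩)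
      · exact ⟨_, h, by rw [Nat.sub_add_cancel (by omega), Nat.mod_self]⟩
      · exact ⟨i, hi, Nat.mod_eq_of_lt hj⟩
    · rintro ⟨i, hi, rfl⟩
      rcases hm i hi with ⟨h, h'⟩ | ⟨h, h'⟩
      · left
        refine ⟨h', ?_⟩
        rwa [← h, Nat.add_sub_cancel]
      · right
        exact ⟨i, hi, h'.symm⟩
  have fin : ∀ I : Finset ℕ, (∀ x, x ∈ I ↔ x = 0 ∧ k - 1 ∈ S) →
      (if (∀ i ∈ S, i ∉ I ∪ S.image (fun i => i + 1)) then
        emW (fun i => qN (c i)) (fun i => -(Polynomial.X ^ (c i - 1))) k I S else 0) =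
      if ∀ i ∈ S, (i + 1) % k ∉ S then (∏ i ∈ S, -(Polynomial.X ^ (c i - 1))) *
          ∏ j ∈ Finset.range k \ (S ∪ S.image (fun i => (i + 1) % k)), qN (c j) else 0 := by
    intro I hI
    have e1 : (∀ i ∈ S, i ∉ I ∪ S.image (fun i => i + 1)) ↔ ∀ i ∈ S, (i + 1) % k ∉ S := by
      constructor
      · intro h i hi hi'
        exact h _ hi' ((key I hI _ (hS' _ hi')).2 (Finset.mem_image_of_mem _ hi))
      · intro h i hi hi'
        obtain ⟨x, hx, hxi⟩ := Finset.mem_image.1 ((key I hI _ (hS' _ hi)).1 hi')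
        exact h x hx (by simpa [hxi] using hi)
    have e2 : Finset.range k \ (S ∪ (I ∪ S.image (fun i => i + 1))) =
        Finset.range k \ (S ∪ S.image (fun i => (i + 1) % k)) := by
      ext j
      rw [Finset.mem_sdiff, Finset.mem_sdiff, Finset.mem_union (s := S), Finset.mem_union (s := S)]
      refine and_congr_right fun hj => ?_
      rw [key I hI j (Finset.mem_range.1 hj)]
    unfold emW
    rw [e2]
    simp only [e1]
  have hkS : k ∈ S.image (fun i => i + 1) ↔ k - 1 ∈ S := by
    rw [Finset.mem_image]
    constructor
    · rintro ⟨i, hi, h⟩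
      rwa [← h, Nat.add_sub_cancel]
    · intro h
      exact ⟨_, h, by omega⟩
  have h0 : k ∉ ({0} : Finset ℕ) := by simp; omega
  by_cases h : k - 1 ∈ S
  · rw [← fin {0} (by simp [h]), if_neg (fun h' => h'.2 (Finset.mem_union_right _ (hkS.2 h))),
      zero_add]
    simp only [Finset.mem_union_right _ (hkS.2 h), and_true]
  · have g : ∀ I : Finset ℕ, k ∉ I → k ∉ I ∪ S.image (fun i => i + 1) := by
      intro I hI hh
      rcases Finset.mem_union.1 hh with h' | h'
      · exact hI h'
      · exact h (hkS.1 h')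
    rw [← fin ∅ (by simp [h])]
    simp only [g ∅ (by simp), g {0} h0, not_false_eq_true, and_true, and_false, if_false, add_zero]
end

section
/- Let k ≥ 2 and let c_1,…,c_k be positive integers. Let Ω be the 2k×2k skew-symmetric matrix over ℤ[q] determined by the following above-diagonal entries (all other entries with row index < column index being 0, and Ω_{j,i} = −Ω_{i,j}): Ω_{1,k} = 1; Ω_{i,k+i} = [c_i]_q for 1 ≤ i ≤ k; Ω_{i,k+i+1} = 1 for 1 ≤ i ≤ k−1; Ω_{i+1,k+i} = q^{c_i−1} for 1 ≤ i ≤ k−1; and Ω_{k+1,2k} = q^{c_k−1}. Then det Ω = (Tr M(c_1,…,c_k)_q)² in ℤ[q]. -/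
/-- The above-diagonal entry of the `2k×2k` skew-symmetric matrix `Ω`, with `i < j`
given as 1-indexed (paper) indices; `c` is 0-indexed, so paper `c_i = c (i−1)`. -/
noncomputable def omegaUpper (k : ℕ) (c : ℕ → ℕ) (i j : ℕ) : Polynomial ℤ :=
  if i = 1 ∧ j = k then 1
  else if 1 ≤ i ∧ i ≤ k ∧ j = k + i then qN (c (i - 1))
  else if 1 ≤ i ∧ i ≤ k - 1 ∧ j = k + i + 1 then 1
  else if 2 ≤ i ∧ i ≤ k ∧ j = k + i - 1 then Polynomial.X ^ (c (i - 2) - 1)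
  else if i = k + 1 ∧ j = 2 * k then Polynomial.X ^ (c (k - 1) - 1)
  else 0

/-- The `2k×2k` skew-symmetric matrix `Ω` of STATEMENT 18 (indices shifted back to
0-indexed `Fin (2k)`). -/
noncomputable def Omega (k : ℕ) (c : ℕ → ℕ) :
    Matrix (Fin (2 * k)) (Fin (2 * k)) (Polynomial ℤ) :=
  Matrix.of fun i j =>
    if (i : ℕ) < (j : ℕ) then omegaUpper k c ((i : ℕ) + 1) ((j : ℕ) + 1)
    else if (j : ℕ) < (i : ℕ) then -(omegaUpper k c ((j : ℕ) + 1) ((i : ℕ) + 1))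
    else 0

namespace Rot
open Matrix

variable {R : Type*} [CommRing R] {S : Type*} [CommRing S]

def J2 (R : Type*) [CommRing R] : Matrix (Fin 2) (Fin 2) R := !![0, 1; -1, 0]

def FF (R : Type*) [CommRing R] {n : Type*} [DecidableEq n] (f : Fin 2 → n) : Matrix n (Fin 2) R :=
  (1 : Matrix n n R).submatrix id f

theorem det_swap {n : Type*} [Fintype n] [DecidableEq n] :
    (fromBlocks (0 : Matrix n n R) (-1 : Matrix n n R) (1 : Matrix n n R) 0).det = 1 := by
  have h : fromBlocks (0 : Matrix n n R) (-1 : Matrix n n R) (1 : Matrix n n R) 0 =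
      fromBlocks (1 : Matrix n n R) (-1) 0 (1 : Matrix n n R) *
      fromBlocks (1 : Matrix n n R) 0 1 (1 : Matrix n n R) *
      fromBlocks (1 : Matrix n n R) (-1) 0 (1 : Matrix n n R) := by
    simp [fromBlocks_multiply]
  rw [h]
  simp

theorem FF_tr {n : Type*} [Fintype n] [DecidableEq n] (f : Fin 2 → n) (N : Matrix n n R) :
    (FF R f)ᵀ * N * FF R f = N.submatrix f f := by
  ext i j
  simp [FF, Matrix.mul_apply, Matrix.one_apply]

theorem det_small (d : R) (G : Matrix (Fin 2) (Fin 2) R) :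
    (1 + d • (J2 R * G * J2 R * Gᵀ)).det = (1 - d * G.det) ^ 2 := by
  rw [Matrix.det_fin_two G, Matrix.det_fin_two]
  simp only [Matrix.add_apply, Matrix.smul_apply, Matrix.mul_apply, Fin.sum_univ_two,
    Matrix.transpose_apply]
  simp [J2]
  ring

theorem det_blocks {n : Type*} [Fintype n] [DecidableEq n] (f : Fin 2 → n) (B : Matrix n n R)
    (hB : IsUnit B.det) (d : R) :
    (fromBlocks (FF R f * J2 R * (FF R f)ᵀ) B (-Bᵀ) (d • (FF R f * J2 R * (FF R f)ᵀ))).det =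
      B.det ^ 2 * (1 - d * (B⁻¹.submatrix f f).det) ^ 2 := by
  set A : Matrix n n R := FF R f * J2 R * (FF R f)ᵀ with hA
  have e1 : (fromBlocks A B (-Bᵀ) (d • A)).det = (fromBlocks B (-A) (d • A) Bᵀ).det := by
    rw [← mul_one (fromBlocks A B (-Bᵀ) (d • A)).det, ← det_swap (R := R) (n := n), ← det_mul,
      fromBlocks_multiply]
    simp
  have := Matrix.invertibleOfIsUnitDet B hB
  rw [e1, det_fromBlocks₁₁, Matrix.invOf_eq_nonsing_inv]
  have e2 : Bᵀ - d • A * B⁻¹ * -A = Bᵀ * (1 + (B⁻¹)ᵀ * (d • A) * B⁻¹ * A) := by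
    rw [mul_add, mul_one, ← mul_assoc, ← mul_assoc, ← mul_assoc, ← Matrix.transpose_mul,
      Matrix.nonsing_inv_mul B hB]
    simp
  have e3 : (B⁻¹)ᵀ * (d • A) * B⁻¹ * A =
      ((B⁻¹)ᵀ * FF R f) * (d • (J2 R * ((FF R f)ᵀ * B⁻¹ * FF R f) * J2 R * (FF R f)ᵀ)) := by
    rw [hA]
    simp only [Matrix.mul_smul, Matrix.smul_mul, Matrix.mul_assoc]
  rw [e2, det_mul, det_transpose, e3, det_one_add_mul_comm, Matrix.smul_mul, FF_tr]
  have e4 : J2 R * B⁻¹.submatrix f f * J2 R * (FF R f)ᵀ * ((B⁻¹)ᵀ * FF R f) =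
      J2 R * B⁻¹.submatrix f f * J2 R * (B⁻¹.submatrix f f)ᵀ := by
    rw [Matrix.mul_assoc _ (FF R f)ᵀ, ← Matrix.mul_assoc (FF R f)ᵀ, FF_tr, transpose_submatrix]
  rw [e4, det_small]
  ring

/-- tridiagonal matrix -/
def T (n : ℕ) (a b : ℕ → R) : Matrix (Fin n) (Fin n) R :=
  Matrix.of fun i j =>
    if (i : ℕ) = j then a i
    else if (j : ℕ) = i + 1 then 1
    else if (i : ℕ) = j + 1 then b j
    else 0

def P (n : ℕ) (a b : ℕ → R) : Matrix (Fin 2) (Fin 2) R :=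
  ((List.range n).map fun i => !![a i, -(b i); 1, 0]).prod

theorem P_succ (n : ℕ) (a b : ℕ → R) : P (n + 1) a b = P n a b * !![a n, -(b n); 1, 0] := by
  simp [P, List.range_succ]

theorem P_succ' (n : ℕ) (a b : ℕ → R) :
    P (n + 1) a b = !![a 0, -(b 0); 1, 0] * P n (fun i => a (i+1)) (fun i => b (i+1)) := by
  simp [P, List.range_succ_eq_map, Function.comp_def]

theorem det_P (n : ℕ) (a b : ℕ → R) : (P n a b).det = ∏ i ∈ Finset.range n, b i := by
  induction n with
  | zero => simp [P]
  | succ n ih => rw [P_succ, det_mul, ih, Finset.prod_range_succ]; simp [Matrix.det_fin_two]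

theorem T_rec (n : ℕ) (a b : ℕ → R) :
    (T (n + 2) a b).det = a 0 * (T (n + 1) (fun i => a (i+1)) (fun i => b (i+1))).det
      - b 0 * (T n (fun i => a (i+2)) (fun i => b (i+2))).det := by
  have hs : (T (n + 2) a b).submatrix Fin.succ Fin.succ
      = T (n + 1) (fun i => a (i+1)) (fun i => b (i+1)) := by
    ext i j; simp [T]
  have h2 : ((T (n + 2) a b).submatrix (Fin.succAbove 1) Fin.succ).det
      = (T n (fun i => a (i+2)) (fun i => b (i+2))).det := by
    rw [Matrix.det_succ_row_zero, Fin.sum_univ_succ, Finset.sum_eq_zero]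
    · have : ((T (n + 2) a b).submatrix (Fin.succAbove 1) Fin.succ).submatrix Fin.succ
          (Fin.succAbove 0) = T n (fun i => a (i+2)) (fun i => b (i+2)) := by
        ext i j
        simp [T, Fin.succAbove, Fin.lt_def]
      rw [this]
      simp [T]
    · intro x _
      simp [T]
  rw [Matrix.det_succ_column_zero, Fin.sum_univ_succ, Fin.sum_univ_succ, Finset.sum_eq_zero]
  · have h1 : ((0 : Fin (n+1)).succ : Fin (n+2)) = 1 := rfl
    rw [h1, h2, Fin.succAbove_zero, hs]
    simp [T]
    ring
  · intro x _
    simp [T]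

theorem det_T (n : ℕ) : ∀ (a b : ℕ → R), (T n a b).det = P n a b 0 0 := by
  induction n using Nat.twoStepInduction with
  | zero => intro a b; simp [P]
  | one => intro a b; simp [P, T]
  | more n ih1 ih2 =>
    intro a b
    rw [T_rec, ih1, ih2, P_succ' (n+1) a b, P_succ' n]
    simp only [Matrix.mul_apply, Fin.sum_univ_two]
    simp
    ring

theorem adj00 (n : ℕ) (a b : ℕ → R) : (T (n+1) a b).adjugate 0 0 = P (n+1) a b 1 0 := by
  rw [Matrix.adjugate_fin_succ_eq_det_submatrix, P_succ']
  have : (T (n + 1) a b).submatrix (Fin.succAbove 0) (Fin.succAbove 0)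
      = T n (fun i => a (i+1)) (fun i => b (i+1)) := by
    ext i j; simp [T]
  rw [this, det_T]
  simp [Matrix.mul_apply, Fin.sum_univ_two]

theorem adjll (n : ℕ) (a b : ℕ → R) :
    (T (n+1) a b).adjugate (Fin.last n) (Fin.last n) = P n a b 0 0 := by
  rw [Matrix.adjugate_fin_succ_eq_det_submatrix]
  have : (T (n + 1) a b).submatrix (Fin.succAbove (Fin.last n)) (Fin.succAbove (Fin.last n))
      = T n a b := by
    ext i j; simp [T]
  rw [this, det_T]
  simp [← two_mul]

theorem adj0l (n : ℕ) (a b : ℕ → R) :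
    (T (n+1) a b).adjugate 0 (Fin.last n) = (-1) ^ n := by
  rw [Matrix.adjugate_fin_succ_eq_det_submatrix, Matrix.det_of_isLowerTriangular]
  · simp [T]
  · intro i j hij
    simp only [OrderDual.toDual_lt_toDual, Fin.lt_def] at hij
    simp [T]
    grind

theorem adjl0 (n : ℕ) (a b : ℕ → R) :
    (T (n+1) a b).adjugate (Fin.last n) 0 = (-1) ^ n * (P n a b).det := by
  rw [Matrix.adjugate_fin_succ_eq_det_submatrix, Matrix.det_of_isUpperTriangular]
  · have h : ∀ x : ℕ, x ≠ x + 1 + 1 := fun x => by omega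
    simp [T, det_P, Finset.prod_range, h]
  · intro i j hij
    simp only [id, Fin.lt_def] at hij
    simp [T]
    grind

/-- the corner choice -/
def cor (n : ℕ) : Fin 2 → Fin (n+1) := ![0, Fin.last n]

def Om (n : ℕ) (a b : ℕ → R) : Matrix (Fin (n+1) ⊕ Fin (n+1)) (Fin (n+1) ⊕ Fin (n+1)) R :=
  fromBlocks (FF R (cor n) * J2 R * (FF R (cor n))ᵀ) (T (n+1) a b) (-(T (n+1) a b)ᵀ)
    (b n • (FF R (cor n) * J2 R * (FF R (cor n))ᵀ))

theorem A_apply (n : ℕ) (i j : Fin (n+1)) :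
    (FF R (cor n) * J2 R * (FF R (cor n))ᵀ) i j =
      (if (i : ℕ) = 0 ∧ (j : ℕ) = n then 1 else 0) - (if (i : ℕ) = n ∧ (j : ℕ) = 0 then 1 else 0) := by
  simp only [Matrix.mul_apply, Fin.sum_univ_two, FF, J2, cor, Matrix.transpose_apply,
    Matrix.submatrix_apply, Matrix.one_apply]
  simp
  simp only [Fin.ext_iff, Fin.val_zero, Fin.val_last]
  grind

theorem unit_case {K : Type*} [Field K] (n : ℕ) (a b : ℕ → K) (h : (T (n+1) a b).det ≠ 0) :
    (Om n a b).det = (P (n+1) a b).trace ^ 2 := by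
  rw [Om, det_blocks _ _ (isUnit_iff_ne_zero.mpr h)]
  have e : ((T (n+1) a b)⁻¹.submatrix (cor n) (cor n)).det =
      (P n a b 1 0) / (T (n+1) a b).det := by
    rw [Matrix.inv_def, Matrix.det_fin_two]
    simp only [submatrix_apply, Matrix.smul_apply, cor, Matrix.cons_val_zero, Matrix.cons_val_one,
      adj00, adjll, adj0l, adjl0, Ring.inverse_eq_inv', smul_eq_mul]
    have hs : ((-1 : K) ^ n) * (-1) ^ n = 1 := by rw [← mul_pow]; simp
    field_simp
    rw [det_T, P_succ, Matrix.det_fin_two]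
    simp [Matrix.mul_apply, Fin.sum_univ_two]
    linear_combination (-(P n a b 0 0 * P n a b 1 1 - P n a b 0 1 * P n a b 1 0)) * hs
  rw [e, ← mul_pow, mul_sub, mul_one]
  have e2 : (T (n+1) a b).det * (b n * (P n a b 1 0 / (T (n+1) a b).det)) = b n * P n a b 1 0 := by
    field_simp
  rw [e2, det_T, Matrix.trace_fin_two]
  congr 1
  have : P (n+1) a b 1 1 = - (b n * P n a b 1 0) := by
    rw [P_succ]; simp [Matrix.mul_apply, Fin.sum_univ_two]; ring
  rw [this]; ring

theorem T_map (f : R →+* S) (n : ℕ) (a b : ℕ → R) :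
    (T n a b).map f = T n (fun i => f (a i)) (fun i => f (b i)) := by
  ext i j; simp only [T, map_apply, of_apply]; split_ifs <;> simp

theorem A_map (f : R →+* S) (n : ℕ) :
    (FF R (cor n) * J2 R * (FF R (cor n))ᵀ : Matrix _ _ R).map f = FF S (cor n) * J2 S * (FF S (cor n))ᵀ := by
  ext i j
  simp [FF, J2, Matrix.mul_apply, Fin.sum_univ_two, Matrix.one_apply, apply_ite f]

theorem det_Om_map (f : R →+* S) (n : ℕ) (a b : ℕ → R) :
    f (Om n a b).det = (Om n (fun i => f (a i)) (fun i => f (b i))).det := by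
  rw [RingHom.map_det]
  congr 1
  rw [RingHom.mapMatrix_apply, Om, Om, fromBlocks_map, A_map, T_map, ← T_map f, ← A_map f]
  congr 1
  · ext i j; simp
  · ext i j; simp only [map_apply, Matrix.smul_apply, smul_eq_mul, map_mul]

theorem P_map (f : R →+* S) (n : ℕ) (a b : ℕ → R) :
    (P n a b).map f = P n (fun i => f (a i)) (fun i => f (b i)) := by
  induction n with
  | zero => simp [P]
  | succ n ih =>
    rw [P_succ, P_succ, Matrix.map_mul, ih]
    congr 1
    ext i j; fin_cases i <;> fin_cases j <;> simp

theorem tr_map (f : R →+* S) (n : ℕ) (a b : ℕ → R) :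
    f ((P n a b).trace ^ 2) = (P n (fun i => f (a i)) (fun i => f (b i))).trace ^ 2 := by
  rw [← P_map, map_pow, Matrix.trace_fin_two, Matrix.trace_fin_two]
  simp

open Polynomial in
theorem main [IsDomain R] (n : ℕ) (a b : ℕ → R) :
    (Om n a b).det = (P (n+1) a b).trace ^ 2 := by
  let a' : ℕ → R[X] := fun i => C (a i) + X
  let b' : ℕ → R[X] := fun i => C (b i)
  have hne : (T (n+1) a' b').det ≠ 0 := by
    have h : T (n+1) a' b' = (X : R[X]) • (1 : Matrix (Fin (n+1)) (Fin (n+1)) R).map C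
        + (T (n+1) a b).map C + (-((X : R[X]) • (1 : Matrix (Fin (n+1)) (Fin (n+1)) R).map C)
        + (X : R[X]) • (1 : Matrix (Fin (n+1)) (Fin (n+1)) R).map C) := by
      rw [T_map]
      ext1 i j
      by_cases hij : i = j
      · subst hij; simp [T, a', add_comm]
      · have : (i : ℕ) ≠ j := fun h => hij (Fin.ext h)
        simp [T, b', hij, this]
    rw [neg_add_cancel, add_zero] at h
    intro h0
    have := Polynomial.leadingCoeff_det_X_one_add_C (T (n+1) a b)
    rw [h] at h0
    rw [Matrix.map_one _ (map_zero _) (map_one _)] at h0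
    simp_all
  have key : (Om n a' b').det = (P (n+1) a' b').trace ^ 2 := by
    apply IsFractionRing.injective R[X] (FractionRing R[X])
    rw [det_Om_map, tr_map]
    apply unit_case
    rw [← T_map, ← RingHom.mapMatrix_apply, ← RingHom.map_det]
    intro h0
    apply hne
    apply IsFractionRing.injective R[X] (FractionRing R[X])
    rw [h0, map_zero]
  have := congrArg (Polynomial.evalRingHom (0 : R)) key
  rw [det_Om_map, tr_map] at this
  simpa [a', b'] using this

end Rot

theorem Rot.Omega_eq (n : ℕ) (c : ℕ → ℕ) :
    (Omega (n+2) c).submatrix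
      ((finSumFinEquiv (m := n+2) (n := n+2)).trans (finCongr (two_mul (n+2)).symm))
      ((finSumFinEquiv (m := n+2) (n := n+2)).trans (finCongr (two_mul (n+2)).symm)) =
    Rot.Om (n+1) (fun i => qN (c i)) (fun i => Polynomial.X ^ (c i - 1)) := by
  ext1 i j
  rcases i with i | i <;> rcases j with j | j
  · have hi := i.2
    have hj := j.2
    simp only [Omega, omegaUpper, Rot.Om, Matrix.submatrix_apply, Matrix.of_apply,
      Matrix.fromBlocks_apply₁₁, Matrix.fromBlocks_apply₂₂, Matrix.smul_apply, Rot.A_apply]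
    simp
    grind
  · have hi := i.2
    have hj := j.2
    simp only [Omega, omegaUpper, Rot.Om, Rot.T, Matrix.submatrix_apply, Matrix.of_apply]
    simp
    grind
  · have hi := i.2
    have hj := j.2
    simp only [Omega, omegaUpper, Rot.Om, Rot.T, Matrix.submatrix_apply, Matrix.of_apply]
    simp
    grind
  · have hi := i.2
    have hj := j.2
    simp only [Omega, omegaUpper, Rot.Om, Matrix.submatrix_apply, Matrix.of_apply,
      Matrix.fromBlocks_apply₁₁, Matrix.fromBlocks_apply₂₂, Matrix.smul_apply, Rot.A_apply]
    simp
    grind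

/-- for `k ≥ 2` and positive integers `c_1,…,c_k`,
`det Ω = (Tr M(c_1,…,c_k)_q)²` in `ℤ[q]`. -/
theorem det_Omega_eq_rotundus_sq (k : ℕ) (hk : 2 ≤ k) (c : ℕ → ℕ)
    (hc : ∀ i < k, 0 < c i) :
    (Omega k c).det = Matrix.trace (Mmat k c) ^ 2 := by
  obtain ⟨n, rfl⟩ := Nat.exists_eq_add_of_le' hk
  rw [← Matrix.det_submatrix_equiv_self
    ((finSumFinEquiv (m := n+2) (n := n+2)).trans (finCongr (two_mul (n+2)).symm)),
    Rot.Omega_eq, Rot.main]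
  rfl
end
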